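/- Let c₁, c₂, k₁, k₂, c ∈ ℝ and suppose D ≠ 0, where D = (c₁² − c₁c₂ + k₂)(4c₁²k₂ − 8c₁c₂k₁ − 2c₁c₂k₂ + 4c₂²k₁ + 16k₁² − 8k₁k₂ + k₂²). Then the vector (α, β, γ) defined by α = −(c/D)(4c₁⁴ − 6c₁³c₂ + 2c₁²c₂² + 5c₁²k₂ − c₁c₂(2k₁ + 3k₂) + 2c₂²k₁ + 8k₁² − 6k₁k₂ + k₂²), β = −(2c/D)(4c₁k₁ + k₂(c₁ − c₂) + 2c₁c₂² − 6c₁²c₂ + 4c₁³), γ = −(2c/D)(2c₁² − 3c₁c₂ + c₂² + 4k₁ − k₂) satisfies the linear system with coefficient matrix [[k₂ − 2k₁, k₁(c₁ − c₂), 2k₁²], [2(c₂ − c₁), k₂ − 4k₁ + c₁² − c₁c₂, 2k₁(3c₁ − c₂)], [2, c₂ − 3c₁, k₂ − 2k₁ + 4c₁² − 2c₁c₂]] and right-hand side (−c, 0, 0), i.e., the matrix applied to (α, β, γ) equals (−c, 0, 0). -/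

import Mathlib

/-- The coefficients `(α, β, γ)` of the quadratic approximation `y = αx² + βxẋ + γẋ²` to
the slow spectral submanifold of the two-degree-of-freedom system solve the linear system
arising from matching quadratic terms in the invariance equation, with right-hand side
`(−c, 0, 0)`. -/
theorem ssm_quadratic_coefficients (c₁ c₂ k₁ k₂ c D α β γ : ℝ)
    (hD : D = (c₁ ^ 2 - c₁ * c₂ + k₂) *
      (4 * c₁ ^ 2 * k₂ - 8 * c₁ * c₂ * k₁ - 2 * c₁ * c₂ * k₂ + 4 * c₂ ^ 2 * k₁
        + 16 * k₁ ^ 2 - 8 * k₁ * k₂ + k₂ ^ 2))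
    (hDne : D ≠ 0)
    (hα : α = -(c / D) * (4 * c₁ ^ 4 - 6 * c₁ ^ 3 * c₂ + 2 * c₁ ^ 2 * c₂ ^ 2
      + 5 * c₁ ^ 2 * k₂ - c₁ * c₂ * (2 * k₁ + 3 * k₂) + 2 * c₂ ^ 2 * k₁
      + 8 * k₁ ^ 2 - 6 * k₁ * k₂ + k₂ ^ 2))
    (hβ : β = -(2 * c / D) * (4 * c₁ * k₁ + k₂ * (c₁ - c₂) + 2 * c₁ * c₂ ^ 2
      - 6 * c₁ ^ 2 * c₂ + 4 * c₁ ^ 3))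
    (hγ : γ = -(2 * c / D) * (2 * c₁ ^ 2 - 3 * c₁ * c₂ + c₂ ^ 2 + 4 * k₁ - k₂)) :
    (k₂ - 2 * k₁) * α + k₁ * (c₁ - c₂) * β + 2 * k₁ ^ 2 * γ = -c ∧
    2 * (c₂ - c₁) * α + (k₂ - 4 * k₁ + c₁ ^ 2 - c₁ * c₂) * β
      + 2 * k₁ * (3 * c₁ - c₂) * γ = 0 ∧
    2 * α + (c₂ - 3 * c₁) * β + (k₂ - 2 * k₁ + 4 * c₁ ^ 2 - 2 * c₁ * c₂) * γ = 0 := by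
  have hc : c / D * D = c := div_mul_cancel₀ c hDne
  rw [mul_div_assoc] at hβ hγ
  generalize c / D = r at hα hβ hγ hc
  subst hα hβ hγ
  refine ⟨?_, by ring, by ring⟩
  rw [← hc, hD]
  ring
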